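/- Let R be a commutative Noetherian ring, 𝔞 an ideal of R, and M a finitely generated R-module. Let t, n₀ be positive integers such that 𝔞^{n₀}·H^i_𝔞(M) = 0 for all i < t. Then for every 𝔞-filter regular element x ∈ 𝔞^{2n₀} of M, there is an isomorphism of R-modules (0 :_{H^{t−1}_𝔞(M/xM)} 𝔞^{n₀}) ≅ H^{t−1}_𝔞(M) ⊕ (0 :_{H^t_𝔞(M)} 𝔞^{n₀}). -/

import Mathlib

open CategoryTheory

namespace LCSplit
noncomputable section
open CategoryTheory.Limits Opposite

variable {R : Type} [CommRing R]

abbrev Fun (M : ModuleCat.{0} R) : ModuleCat.{0} R ⥤ (ModuleCat.{0} R)ᵒᵖ :=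
  ((linearYoneda R (ModuleCat.{0} R)).obj M).rightOp

abbrev Kc {X : ModuleCat.{0} R} (P : ProjectiveResolution X) (M : ModuleCat.{0} R) :
    ChainComplex (ModuleCat.{0} R)ᵒᵖ ℕ :=
  ((Fun M).mapHomologicalComplex _).obj P.complex

abbrev OldExt (X M : ModuleCat.{0} R) (i : ℕ) : ModuleCat.{0} R :=
  ((Ext R (ModuleCat.{0} R) i).obj (op X)).obj M

abbrev Zc {X : ModuleCat.{0} R} (P : ProjectiveResolution X) (M : ModuleCat.{0} R) (i : ℕ) :
    ModuleCat.{0} R := ((Kc P M).opcycles i).unop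

def kap {X : ModuleCat.{0} R} (P : ProjectiveResolution X) (M : ModuleCat.{0} R) (i : ℕ) :
    Zc P M i ⟶ ModuleCat.of R (P.complex.X i ⟶ M) := ((Kc P M).pOpcycles i).unop

def isoD {X : ModuleCat.{0} R} (P : ProjectiveResolution X) (M : ModuleCat.{0} R) (i : ℕ) :
    ((Fun M).leftDerived i).obj X ≅ (Kc P M).homology i := P.isoLeftDerivedObj (Fun M) i

def alp {X : ModuleCat.{0} R} (P : ProjectiveResolution X) (M : ModuleCat.{0} R) (i : ℕ) :
    Zc P M i ⟶ OldExt X M i :=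
  ((isoD P M i).hom ≫ (Kc P M).homologyι i).unop

instance {X : ModuleCat.{0} R} (P : ProjectiveResolution X) (M : ModuleCat.{0} R) (i : ℕ) :
    Mono (kap P M i) :=
  unop_mono_of_epi ((Kc P M).pOpcycles i)

lemma alp_epi {X : ModuleCat.{0} R} (P : ProjectiveResolution X) (M : ModuleCat.{0} R) (i : ℕ) :
    Epi (alp P M i) := by
  have : Mono ((isoD P M i).hom ≫ (Kc P M).homologyι i) := mono_comp _ _
  exact unop_epi_of_mono ((isoD P M i).hom ≫ (Kc P M).homologyι i)

lemma kap_cocycle {X : ModuleCat.{0} R} (P : ProjectiveResolution X) (M : ModuleCat.{0} R) (i : ℕ)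
    (z : Zc P M i) : P.complex.d (i+1) i ≫ (show P.complex.X i ⟶ M from kap P M i z) = 0 := by
  have h := (Kc P M).d_pOpcycles (i+1) i
  have h2 := congrArg Quiver.Hom.unop h
  have h3 := congrArg (fun f => f.hom z) h2
  exact h3

lemma kap_surj {X : ModuleCat.{0} R} (P : ProjectiveResolution X) (M : ModuleCat.{0} R) (i : ℕ)
    (f : P.complex.X i ⟶ M) (hf : P.complex.d (i+1) i ≫ f = 0) : ∃ z, kap P M i z = f := by
  let φ : ModuleCat.of R R ⟶ ModuleCat.of R (P.complex.X i ⟶ M) :=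
    ModuleCat.ofHom (LinearMap.toSpanSingleton R _ f)
  let g : (Kc P M).X i ⟶ op (ModuleCat.of R R) := φ.op
  have hg : (Kc P M).d (i+1) i ≫ g = 0 := by
    apply Quiver.Hom.unop_inj
    ext
    change P.complex.d (i+1) i ≫ ((1:R) • f) = 0
    rw [one_smul, hf]
  refine ⟨((Kc P M).descOpcycles g (i+1) (by simp) hg).unop.hom (1:R), ?_⟩
  have h := (Kc P M).p_descOpcycles g (i+1) (by simp) hg
  have h3 := congrArg (fun f : (Kc P M).X i ⟶ op (ModuleCat.of R R) => f.unop.hom (1:R)) h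
  refine Eq.trans h3 ?_
  exact one_smul R f

lemma alp_eq_zero_iff {X : ModuleCat.{0} R} (P : ProjectiveResolution X) (M : ModuleCat.{0} R)
    (i : ℕ) (z : Zc P M i) :
    alp P M i z = 0 ↔ ∃ w : ((Kc P M).X ((ComplexShape.down ℕ).next i)).unop, ((Kc P M).fromOpcycles i ((ComplexShape.down ℕ).next i)).unop.hom w = z := by
  let S : ShortComplex (ModuleCat.{0} R)ᵒᵖ := ShortComplex.mk
    ((isoD P M i).hom ≫ (Kc P M).homologyι i)
    ((Kc P M).fromOpcycles i ((ComplexShape.down ℕ).next i)) (by simp)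
  have hS : S.Exact := by
    let S' : ShortComplex (ModuleCat.{0} R)ᵒᵖ := ShortComplex.mk ((Kc P M).homologyι i)
      ((Kc P M).fromOpcycles i ((ComplexShape.down ℕ).next i)) (by simp)
    have hS' : S'.Exact := ShortComplex.exact_of_f_is_kernel _
      ((Kc P M).homologyIsKernel i _ rfl)
    refine (ShortComplex.exact_iff_of_iso
      (ShortComplex.isoMk (isoD P M i) (Iso.refl _) (Iso.refl _)
        ?_ ?_ : S ≅ S')).2 hS' <;> simp [S, S']
  have := (ShortComplex.moduleCat_exact_iff _).1 hS.unop
  constructor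
  · intro h; exact this z h
  · rintro ⟨w, rfl⟩
    exact congrArg (fun f => f.hom w) S.unop.zero


lemma alp_eq_zero_iff_zero {X : ModuleCat.{0} R} (P : ProjectiveResolution X) (M : ModuleCat.{0} R)
    (z : Zc P M 0) : alp P M 0 z = 0 ↔ kap P M 0 z = 0 := by
  have inj : Function.Injective (kap P M 0) := (ModuleCat.mono_iff_injective _).1 inferInstance
  rw [alp_eq_zero_iff]
  have h0 : (Kc P M).fromOpcycles 0 ((ComplexShape.down ℕ).next 0) = 0 := by
    rw [← cancel_epi ((Kc P M).pOpcycles 0), HomologicalComplex.p_fromOpcycles, comp_zero]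
    exact (Kc P M).shape _ _ (by simp)
  constructor
  · rintro ⟨w, rfl⟩
    rw [h0]
    exact map_zero (kap P M 0).hom
  · intro h
    refine ⟨0, ?_⟩
    apply inj
    rw [h, map_zero]
    exact map_zero (kap P M 0).hom

lemma alp_eq_zero_iff_succ {X : ModuleCat.{0} R} (P : ProjectiveResolution X) (M : ModuleCat.{0} R)
    (i : ℕ) (z : Zc P M (i+1)) : alp P M (i+1) z = 0 ↔
      ∃ g : P.complex.X i ⟶ M, P.complex.d (i+1) i ≫ g = kap P M (i+1) z := by
  have inj : Function.Injective (kap P M (i+1)) := (ModuleCat.mono_iff_injective _).1 inferInstance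
  rw [alp_eq_zero_iff]
  have hn : (ComplexShape.down ℕ).next (i+1) = i := ChainComplex.next_nat_succ i
  rw [hn]
  have h := (Kc P M).p_fromOpcycles (i+1) i
  have h3 : ∀ w, kap P M (i+1) (((Kc P M).fromOpcycles (i+1) i).unop.hom w) =
     P.complex.d (i+1) i ≫ (show P.complex.X i ⟶ M from w) := fun w =>
    congrArg (fun f : (Kc P M).X (i+1) ⟶ (Kc P M).X i => f.unop.hom w) h
  constructor
  · rintro ⟨w, rfl⟩
    exact ⟨w, (h3 w).symm⟩
  · rintro ⟨g, hg⟩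
    exact ⟨g, inj ((h3 g).trans hg)⟩

lemma extMk_eq_zero_iff_zero {X : ModuleCat.{0} R} (P : ProjectiveResolution X)
    (M : ModuleCat.{0} R) (f : P.complex.X 0 ⟶ M) (hf : P.complex.d 1 0 ≫ f = 0) :
    P.extMk f 1 rfl hf = 0 ↔ f = 0 := by
  constructor
  · intro h
    simp only [← P.extEquivCohomologyClass.apply_eq_iff_eq,
      ProjectiveResolution.extEquivCohomologyClass_extMk,
      ProjectiveResolution.extEquivCohomologyClass_zero,
      CochainComplex.HomComplex.CohomologyClass.mk_eq_zero_iff] at h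
    rw [CochainComplex.HomComplex.Cocycle.toSingleMk_mem_coboundaries_iff _ _ _ _ _ 1 (by simp)] at h
    obtain ⟨g, hg⟩ := h
    have hd : P.cochainComplex.d (-((0:ℕ):ℤ)) 1 = 0 := by
      apply IsZero.eq_of_tgt
      exact P.cochainComplex.isZero_of_isStrictlyLE 0 1 (by simp)
    rw [← cancel_epi (P.cochainComplexXIso (-((0:ℕ):ℤ)) 0 rfl).hom, ← hg, hd]
    simp
  · rintro rfl
    simp

def bet {X : ModuleCat.{0} R} (P : ProjectiveResolution X) (M : ModuleCat.{0} R) (i : ℕ) :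
    Zc P M i →ₗ[R] Abelian.Ext X M i where
  toFun z := P.extMk (show P.complex.X i ⟶ M from kap P M i z) (i+1) rfl (kap_cocycle P M i z)
  map_add' z w := by
    rw [ProjectiveResolution.add_extMk]
    congr 1
    exact map_add (kap P M i).hom z w
  map_smul' r z := by
    rw [RingHom.id_apply, Abelian.Ext.smul_eq_comp_mk₀, ProjectiveResolution.extMk_comp_mk₀]
    congr 1
    refine (map_smul (kap P M i).hom r z).trans ?_
    rw [Linear.comp_smul, Category.comp_id]

lemma bet_surj {X : ModuleCat.{0} R} (P : ProjectiveResolution X) (M : ModuleCat.{0} R) (i : ℕ) :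
    Function.Surjective (bet P M i) := by
  intro e
  obtain ⟨f, hf, rfl⟩ := P.extMk_surjective e (i+1) rfl
  obtain ⟨z, rfl⟩ := kap_surj P M i f hf
  exact ⟨z, rfl⟩

lemma alp_surj {X : ModuleCat.{0} R} (P : ProjectiveResolution X) (M : ModuleCat.{0} R) (i : ℕ) :
    Function.Surjective (alp P M i).hom := (ModuleCat.epi_iff_surjective _).1 (alp_epi P M i)

lemma ker_eq {X : ModuleCat.{0} R} (P : ProjectiveResolution X) (M : ModuleCat.{0} R) (i : ℕ) :
    LinearMap.ker (bet P M i) = LinearMap.ker (alp P M i).hom := by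
  ext z
  rw [LinearMap.mem_ker, LinearMap.mem_ker]
  cases i with
  | zero =>
    exact (extMk_eq_zero_iff_zero P M _ (kap_cocycle P M 0 z)).trans (alp_eq_zero_iff_zero P M z).symm
  | succ i =>
    exact (P.extMk_eq_zero_iff _ _ rfl (kap_cocycle P M (i+1) z) i rfl).trans
      (alp_eq_zero_iff_succ P M i z).symm

def Phi {X : ModuleCat.{0} R} (P : ProjectiveResolution X) (M : ModuleCat.{0} R) (i : ℕ) :
    Abelian.Ext X M i ≃ₗ[R] OldExt X M i :=
  ((bet P M i).quotKerEquivOfSurjective (bet_surj P M i)).symm ≪≫ₗ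
    Submodule.quotEquivOfEq _ _ (ker_eq P M i) ≪≫ₗ
    ((alp P M i).hom.quotKerEquivOfSurjective (alp_surj P M i))

lemma Phi_bet {X : ModuleCat.{0} R} (P : ProjectiveResolution X) (M : ModuleCat.{0} R) (i : ℕ)
    (z : Zc P M i) : Phi P M i (bet P M i z) = (alp P M i).hom z := by
  have : ((bet P M i).quotKerEquivOfSurjective (bet_surj P M i)).symm (bet P M i z) =
      Submodule.Quotient.mk z := by
    rw [LinearEquiv.symm_apply_eq]; rfl
  simp only [Phi, LinearEquiv.trans_apply, this]
  rfl

/-- naturality in `M`. -/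
lemma Phi_natural {X : ModuleCat.{0} R} (P : ProjectiveResolution X) {M N : ModuleCat.{0} R}
    (g : M ⟶ N) (i : ℕ) (e : Abelian.Ext X M i) :
    Phi P N i (e.comp (Abelian.Ext.mk₀ g) (add_zero _)) =
      (((Ext R (ModuleCat.{0} R) i).obj (op X)).map g).hom (Phi P M i e) := by
  obtain ⟨z, rfl⟩ := bet_surj P M i e
  let γ : Kc P N ⟶ Kc P M := 
    (NatTrans.mapHomologicalComplex (((linearYoneda R (ModuleCat.{0} R)).map g).rightOp) _).app P.complex
  let w : Zc P N i := (HomologicalComplex.opcyclesMap γ i).unop.hom z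
  have hw : kap P N i w = (show P.complex.X i ⟶ M from kap P M i z) ≫ g :=
    congrArg (fun f : (Kc P N).X i ⟶ (Kc P M).opcycles i => f.unop.hom z) 
      (HomologicalComplex.p_opcyclesMap γ i)
  have hb : (bet P M i z).comp (Abelian.Ext.mk₀ g) (add_zero _) = bet P N i w := by
    refine (P.extMk_comp_mk₀ _ _ rfl (kap_cocycle P M i z) g).trans ?_
    simp only [← hw]
    rfl
  rw [hb, Phi_bet, Phi_bet]
  have key : (isoD P N i).hom ≫ (Kc P N).homologyι i ≫ HomologicalComplex.opcyclesMap γ i =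
      (NatTrans.leftDerived (((linearYoneda R (ModuleCat.{0} R)).map g).rightOp) i).app X ≫
        (isoD P M i).hom ≫ (Kc P M).homologyι i := by
    rw [P.leftDerived_app_eq, ← HomologicalComplex.homologyι_naturality]
    simp only [Category.assoc]
    erw [Iso.inv_hom_id_assoc]
    rfl
  exact congrArg (fun f : ((Fun N).leftDerived i).obj X ⟶ (Kc P M).opcycles i => f.unop.hom z) key

/-- naturality in `X`. -/
lemma Phi_natural' {X Y : ModuleCat.{0} R} (P : ProjectiveResolution X) 
    (Q : ProjectiveResolution Y) (g : X ⟶ Y) (M : ModuleCat.{0} R)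
    (i : ℕ) (e : Abelian.Ext Y M i) :
    Phi P M i ((Abelian.Ext.mk₀ g).comp e (zero_add _)) =
      (((Ext R (ModuleCat.{0} R) i).map g.op).app M).hom (Phi Q M i e) := by
  obtain ⟨z, rfl⟩ := bet_surj Q M i e
  let φ : P.Hom Q g := ⟨ProjectiveResolution.lift g P Q,
    ProjectiveResolution.lift_commutes_zero g P Q⟩
  let γ : Kc P M ⟶ Kc Q M := ((Fun M).mapHomologicalComplex _).map φ.hom
  let w : Zc P M i := (HomologicalComplex.opcyclesMap γ i).unop.hom z
  have hw : kap P M i w = φ.hom.f i ≫ (show Q.complex.X i ⟶ M from kap Q M i z) :=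
    congrArg (fun f : (Kc P M).X i ⟶ (Kc Q M).opcycles i => f.unop.hom z) 
      (HomologicalComplex.p_opcyclesMap γ i)
  have hb : (Abelian.Ext.mk₀ g).comp (bet Q M i z) (zero_add _) = bet P M i w := by
    refine (ProjectiveResolution.mk₀_comp_extMk _ _ rfl (kap_cocycle Q M i z) φ).trans ?_
    simp only [← hw]
    rfl
  rw [hb, Phi_bet, Phi_bet]
  have key : (isoD P M i).hom ≫ (Kc P M).homologyι i ≫ HomologicalComplex.opcyclesMap γ i =
      ((Fun M).leftDerived i).map g ≫ (isoD Q M i).hom ≫ (Kc Q M).homologyι i := by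
    have h := ProjectiveResolution.isoLeftDerivedObj_hom_naturality g P Q φ.hom
      (ProjectiveResolution.lift_commutes_zero g P Q) (Fun M) i
    rw [← HomologicalComplex.homologyι_naturality]
    have h' : ((Fun M).leftDerived i).map g ≫ (isoD Q M i).hom =
      (isoD P M i).hom ≫ HomologicalComplex.homologyMap γ i := h
    rw [← Category.assoc, ← Category.assoc, h']
  exact congrArg (fun f : ((Fun M).leftDerived i).obj X ⟶ (Kc Q M).opcycles i => f.unop.hom z) key


section interface
variable (𝔞 : Ideal R)

abbrev Rq (n : ℕ) : ModuleCat.{0} R := ModuleCat.of R (R ⧸ 𝔞 ^ n)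

abbrev pr {n m : ℕ} (h : n ≤ m) : Rq 𝔞 m ⟶ Rq 𝔞 n :=
  ModuleCat.ofHom (Submodule.mapQ _ _ LinearMap.id (Ideal.pow_le_pow_right h))

abbrev TT (i : ℕ) (M : ModuleCat.{0} R) : ModuleCat.{0} R := (localCohomology 𝔞 i).obj M

abbrev Dg (i : ℕ) := localCohomology.diagram (localCohomology.idealPowersDiagram 𝔞) i

abbrev Fg (i : ℕ) (M : ModuleCat.{0} R) : (ℕᵒᵖ)ᵒᵖ ⥤ ModuleCat.{0} R :=
  Dg 𝔞 i ⋙ (evaluation _ _).obj M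

abbrev coc (i : ℕ) (M : ModuleCat.{0} R) : Cocone (Fg 𝔞 i M) :=
  ((evaluation _ _).obj M).mapCocone (colimit.cocone (Dg 𝔞 i))

def cocIs (i : ℕ) (M : ModuleCat.{0} R) : IsColimit (coc 𝔞 i M) :=
  isColimitOfPreserves _ (colimit.isColimit (Dg 𝔞 i))

def iotaOld (i : ℕ) (M : ModuleCat.{0} R) (n : ℕ) : OldExt (Rq 𝔞 n) M i ⟶ TT 𝔞 i M :=
  (coc 𝔞 i M).ι.app (op (op n))

abbrev Pn (n : ℕ) : ProjectiveResolution (Rq 𝔞 n) := projectiveResolution (Rq 𝔞 n)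

def iota (i : ℕ) (M : ModuleCat.{0} R) (n : ℕ) : Abelian.Ext (Rq 𝔞 n) M i →ₗ[R] TT 𝔞 i M :=
  (iotaOld 𝔞 i M n).hom ∘ₗ (Phi (Pn 𝔞 n) M i).toLinearMap

abbrev Tmap (i : ℕ) {M N : ModuleCat.{0} R} (g : M ⟶ N) : TT 𝔞 i M →ₗ[R] TT 𝔞 i N :=
  ((localCohomology 𝔞 i).map g).hom

lemma iota_surj (i : ℕ) (M : ModuleCat.{0} R) (v : TT 𝔞 i M) : ∃ n e, iota 𝔞 i M n e = v := by
  obtain ⟨j, y, hy⟩ := Concrete.isColimit_exists_rep (Fg 𝔞 i M) (cocIs 𝔞 i M) v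
  obtain ⟨e, rfl⟩ := (Phi (Pn 𝔞 j.unop.unop) M i).surjective y
  exact ⟨j.unop.unop, e, hy⟩

lemma iota_pr (i : ℕ) (M : ModuleCat.{0} R) {n m : ℕ} (h : n ≤ m) (e : Abelian.Ext (Rq 𝔞 n) M i) :
    iota 𝔞 i M m ((Abelian.Ext.mk₀ (pr 𝔞 h)).comp e (zero_add _)) = iota 𝔞 i M n e := by
  have h1 := (coc 𝔞 i M).w (homOfLE h).op.op
  have h2 := congrArg (fun f => f.hom (Phi (Pn 𝔞 n) M i e)) h1
  refine Eq.trans ?_ h2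
  refine congrArg (iotaOld 𝔞 i M m).hom (Phi_natural' (Pn 𝔞 m) (Pn 𝔞 n) (pr 𝔞 h) M i e)

lemma iota_map (i : ℕ) {M N : ModuleCat.{0} R} (g : M ⟶ N) {n : ℕ}
    (e : Abelian.Ext (Rq 𝔞 n) M i) :
    Tmap 𝔞 i g (iota 𝔞 i M n e) = iota 𝔞 i N n (e.comp (Abelian.Ext.mk₀ g) (add_zero _)) := by
  have h1 := ((colimit.cocone (Dg 𝔞 i)).ι.app (op (op n))).naturality g
  have h2 := congrArg (fun f => f.hom (Phi (Pn 𝔞 n) M i e)) h1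
  refine Eq.trans h2.symm ?_
  exact congrArg (iotaOld 𝔞 i N n).hom (Phi_natural (Pn 𝔞 n) g i e).symm

lemma iota_eq_zero (i : ℕ) (M : ModuleCat.{0} R) {n : ℕ} (e : Abelian.Ext (Rq 𝔞 n) M i)
    (he : iota 𝔞 i M n e = 0) : ∃ m, ∃ h : n ≤ m,
      (Abelian.Ext.mk₀ (pr 𝔞 h)).comp e (zero_add _) = 0 := by
  have h0 : (coc 𝔞 i M).ι.app (op (op n)) (Phi (Pn 𝔞 n) M i e) =
    (coc 𝔞 i M).ι.app (op (op n)) (0 : OldExt (Rq 𝔞 n) M i) := 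
      he.trans (map_zero (iotaOld 𝔞 i M n).hom).symm
  obtain ⟨k, f, g, hfg⟩ := (Concrete.isColimit_rep_eq_iff_exists (Fg 𝔞 i M) (cocIs 𝔞 i M)
    (i := op (op n)) (j := op (op n)) (Phi (Pn 𝔞 n) M i e) (0 : OldExt (Rq 𝔞 n) M i)).1 h0
  have hle : n ≤ k.unop.unop := leOfHom f.unop.unop
  refine ⟨k.unop.unop, hle, ?_⟩
  apply (Phi (Pn 𝔞 k.unop.unop) M i).injective
  rw [map_zero, Phi_natural' (Pn 𝔞 k.unop.unop) (Pn 𝔞 n) (pr 𝔞 hle) M i e]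
  exact hfg.trans (map_zero ((Fg 𝔞 i M).map g).hom)

lemma iota_desc (i : ℕ) (M : ModuleCat.{0} R) (W : ModuleCat.{0} R)
    (f : ∀ n, Abelian.Ext (Rq 𝔞 n) M i →ₗ[R] W)
    (hf : ∀ n m (h : n ≤ m) e, f m ((Abelian.Ext.mk₀ (pr 𝔞 h)).comp e (zero_add _)) = f n e) :
    ∃ g : TT 𝔞 i M →ₗ[R] W, ∀ n e, g (iota 𝔞 i M n e) = f n e := by
  let s : Cocone (Fg 𝔞 i M) :=
    { pt := W
      ι := { app := fun j => ModuleCat.ofHom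
                ((f j.unop.unop) ∘ₗ (Phi (Pn 𝔞 j.unop.unop) M i).symm.toLinearMap)
             naturality := by
              intro j k u
              ext y
              obtain ⟨e, rfl⟩ := (Phi (Pn 𝔞 j.unop.unop) M i).surjective y
              have hle : j.unop.unop ≤ k.unop.unop := leOfHom u.unop.unop
              have := Phi_natural' (Pn 𝔞 k.unop.unop) (Pn 𝔞 j.unop.unop) (pr 𝔞 hle) M i e
              change f _ ((Phi (Pn 𝔞 k.unop.unop) M i).symm
                ((((Ext R (ModuleCat.{0} R) i).map (pr 𝔞 hle).op).app M).hom _)) =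
                f _ ((Phi (Pn 𝔞 j.unop.unop) M i).symm _)
              rw [← this, LinearEquiv.symm_apply_apply, LinearEquiv.symm_apply_apply, hf] } }
  refine ⟨((cocIs 𝔞 i M).desc s).hom, fun n e => ?_⟩
  have h1 := (cocIs 𝔞 i M).fac s (op (op n))
  have h2 := congrArg (fun f => f.hom (Phi (Pn 𝔞 n) M i e)) h1
  refine Eq.trans h2 ?_
  exact congrArg (f n) ((Phi (Pn 𝔞 n) M i).symm_apply_apply e)


lemma Tmap_id (i : ℕ) (M : ModuleCat.{0} R) (v : TT 𝔞 i M) : Tmap 𝔞 i (𝟙 M) v = v := by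
  simp [Tmap]

lemma Tmap_comp (i : ℕ) {M N K : ModuleCat.{0} R} (f : M ⟶ N) (g : N ⟶ K) (v : TT 𝔞 i M) :
    Tmap 𝔞 i (f ≫ g) v = Tmap 𝔞 i g (Tmap 𝔞 i f v) := by
  simp [Tmap]

lemma Tmap_add (i : ℕ) {M N : ModuleCat.{0} R} (f g : M ⟶ N) (v : TT 𝔞 i M) :
    Tmap 𝔞 i (f + g) v = Tmap 𝔞 i f v + Tmap 𝔞 i g v := by
  obtain ⟨n, e, rfl⟩ := iota_surj 𝔞 i M v
  simp only [iota_map, Abelian.Ext.mk₀_add, Abelian.Ext.comp_add, map_add]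

lemma Tmap_smul (i : ℕ) {M N : ModuleCat.{0} R} (r : R) (f : M ⟶ N) (v : TT 𝔞 i M) :
    Tmap 𝔞 i (r • f) v = r • Tmap 𝔞 i f v := by
  obtain ⟨n, e, rfl⟩ := iota_surj 𝔞 i M v
  simp only [iota_map, Abelian.Ext.mk₀_smul, Abelian.Ext.comp_smul, map_smul]

lemma Tmap_zero (i : ℕ) {M N : ModuleCat.{0} R} (v : TT 𝔞 i M) :
    Tmap 𝔞 i (0 : M ⟶ N) v = 0 := by
  have := Tmap_smul 𝔞 i (0 : R) (0 : M ⟶ N) v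
  simpa using this

lemma Tmap_sum (i : ℕ) {M N : ModuleCat.{0} R} {ι : Type} (s : Finset ι) (f : ι → (M ⟶ N))
    (v : TT 𝔞 i M) : Tmap 𝔞 i (∑ j ∈ s, f j) v = ∑ j ∈ s, Tmap 𝔞 i (f j) v := by
  classical
  induction s using Finset.induction_on with
  | empty => simpa using Tmap_zero 𝔞 i v
  | insert a s ha ih => rw [Finset.sum_insert ha, Finset.sum_insert ha, Tmap_add, ih]

lemma exists_delta (i : ℕ) {S : ShortComplex (ModuleCat.{0} R)} (hS : S.ShortExact) :
    ∃ δ : TT 𝔞 i S.X₃ →ₗ[R] TT 𝔞 (i+1) S.X₁, ∀ n e,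
      δ (iota 𝔞 i S.X₃ n e) = iota 𝔞 (i+1) S.X₁ n (e.comp hS.extClass rfl) := by
  refine iota_desc 𝔞 i S.X₃ _ (fun n => iota 𝔞 (i+1) S.X₁ n ∘ₗ
    (Abelian.Ext.postcompOfLinear hS.extClass R (Rq 𝔞 n) rfl)) ?_
  intro n m h e
  refine Eq.trans ?_ (iota_pr 𝔞 (i+1) S.X₁ h (e.comp hS.extClass rfl))
  change iota 𝔞 (i+1) S.X₁ m _ = _
  congr 1
  exact Abelian.Ext.comp_assoc _ _ _ (zero_add _) rfl (by omega)

def delta (i : ℕ) {S : ShortComplex (ModuleCat.{0} R)} (hS : S.ShortExact) :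
    TT 𝔞 i S.X₃ →ₗ[R] TT 𝔞 (i+1) S.X₁ := (exists_delta 𝔞 i hS).choose

lemma delta_iota (i : ℕ) {S : ShortComplex (ModuleCat.{0} R)} (hS : S.ShortExact) (n : ℕ)
    (e : Abelian.Ext (Rq 𝔞 n) S.X₃ i) :
    delta 𝔞 i hS (iota 𝔞 i S.X₃ n e) = iota 𝔞 (i+1) S.X₁ n (e.comp hS.extClass rfl) :=
  (exists_delta 𝔞 i hS).choose_spec n e

lemma delta_natural (i : ℕ) {S S' : ShortComplex (ModuleCat.{0} R)} (hS : S.ShortExact)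
    (hS' : S'.ShortExact) (φ : S ⟶ S') (v : TT 𝔞 i S.X₃) :
    delta 𝔞 i hS' (Tmap 𝔞 i φ.τ₃ v) = Tmap 𝔞 (i+1) φ.τ₁ (delta 𝔞 i hS v) := by
  obtain ⟨n, e, rfl⟩ := iota_surj 𝔞 i _ v
  rw [iota_map, delta_iota, delta_iota, iota_map]
  congr 1
  rw [Abelian.Ext.comp_assoc e (Abelian.Ext.mk₀ φ.τ₃) hS'.extClass (add_zero _) (zero_add _) rfl,
    ← ShortComplex.ShortExact.extClass_naturality hS hS' φ]
  exact (Abelian.Ext.comp_assoc _ _ _ rfl (add_zero _) rfl).symm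

lemma delta_Tmap (i : ℕ) {S : ShortComplex (ModuleCat.{0} R)} (hS : S.ShortExact)
    (v : TT 𝔞 i S.X₂) : delta 𝔞 i hS (Tmap 𝔞 i S.g v) = 0 := by
  obtain ⟨n, e, rfl⟩ := iota_surj 𝔞 i _ v
  rw [iota_map, delta_iota,
    Abelian.Ext.comp_assoc e (Abelian.Ext.mk₀ S.g) hS.extClass (add_zero _) (zero_add _) rfl]
  simp

lemma Tmap_delta (i : ℕ) {S : ShortComplex (ModuleCat.{0} R)} (hS : S.ShortExact)
    (v : TT 𝔞 i S.X₃) : Tmap 𝔞 (i+1) S.f (delta 𝔞 i hS v) = 0 := by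
  obtain ⟨n, e, rfl⟩ := iota_surj 𝔞 i _ v
  rw [delta_iota, iota_map,
    Abelian.Ext.comp_assoc e hS.extClass (Abelian.Ext.mk₀ S.f) rfl (add_zero _) rfl]
  simp

lemma exact₂ (i : ℕ) {S : ShortComplex (ModuleCat.{0} R)} (hS : S.ShortExact)
    (v : TT 𝔞 i S.X₂) (hv : Tmap 𝔞 i S.g v = 0) : ∃ u, Tmap 𝔞 i S.f u = v := by
  obtain ⟨n, e, rfl⟩ := iota_surj 𝔞 i _ v
  rw [iota_map] at hv
  obtain ⟨m, h, hm⟩ := iota_eq_zero 𝔞 i _ _ hv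
  rw [← Abelian.Ext.comp_assoc _ _ _ (zero_add _) (add_zero _) (by omega)] at hm
  obtain ⟨e', he'⟩ := Abelian.Ext.covariant_sequence_exact₂ _ hS _ hm
  exact ⟨iota 𝔞 i _ m e', by rw [iota_map, he', iota_pr]⟩

lemma exact₃ (i : ℕ) {S : ShortComplex (ModuleCat.{0} R)} (hS : S.ShortExact)
    (v : TT 𝔞 i S.X₃) (hv : delta 𝔞 i hS v = 0) : ∃ u, Tmap 𝔞 i S.g u = v := by
  obtain ⟨n, e, rfl⟩ := iota_surj 𝔞 i _ v
  rw [delta_iota] at hv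
  obtain ⟨m, h, hm⟩ := iota_eq_zero 𝔞 (i+1) _ _ hv
  rw [← Abelian.Ext.comp_assoc _ _ _ (zero_add _) rfl (by omega)] at hm
  obtain ⟨e', he'⟩ := Abelian.Ext.covariant_sequence_exact₃ _ hS _ _ hm
  exact ⟨iota 𝔞 i _ m e', by rw [iota_map, he', iota_pr]⟩

lemma exact₁ (i : ℕ) {S : ShortComplex (ModuleCat.{0} R)} (hS : S.ShortExact)
    (v : TT 𝔞 (i+1) S.X₁) (hv : Tmap 𝔞 (i+1) S.f v = 0) : ∃ u, delta 𝔞 i hS u = v := by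
  obtain ⟨n, e, rfl⟩ := iota_surj 𝔞 (i+1) _ v
  rw [iota_map] at hv
  obtain ⟨m, h, hm⟩ := iota_eq_zero 𝔞 (i+1) _ _ hv
  rw [← Abelian.Ext.comp_assoc _ _ _ (zero_add _) (add_zero _) (by omega)] at hm
  obtain ⟨e', he'⟩ := Abelian.Ext.covariant_sequence_exact₁ _ hS _ hm rfl
  exact ⟨iota 𝔞 i _ m e', by rw [delta_iota, he', iota_pr]⟩

lemma T_injective (i : ℕ) (J : ModuleCat.{0} R) [Injective J] (v : TT 𝔞 (i+1) J) : v = 0 := by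
  obtain ⟨n, e, rfl⟩ := iota_surj 𝔞 (i+1) _ v
  rw [e.eq_zero_of_injective, map_zero]


def Gam (E : Type) [AddCommGroup E] [Module R E] : Submodule R E where
  carrier := {v | ∃ k : ℕ, ∀ r ∈ 𝔞 ^ k, r • v = 0}
  add_mem' := by
    rintro a b ⟨k, hk⟩ ⟨l, hl⟩
    refine ⟨k + l, fun r hr => ?_⟩
    rw [smul_add, hk r (Ideal.pow_le_pow_right (by omega) hr),
      hl r (Ideal.pow_le_pow_right (by omega) hr), add_zero]
  zero_mem' := ⟨0, fun r _ => smul_zero r⟩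
  smul_mem' := by
    rintro c v ⟨k, hk⟩
    exact ⟨k, fun r hr => by rw [smul_comm, hk r hr, smul_zero]⟩

lemma unif (E : Type) [AddCommGroup E] [Module R E] (N : Submodule R E) (hN : N.FG)
    (h : N ≤ Gam 𝔞 E) : ∃ k : ℕ, ∀ r ∈ 𝔞 ^ k, ∀ v ∈ N, r • v = 0 := by
  revert h
  induction N, hN using Submodule.fg_induction with
  | singleton x =>
    intro h
    obtain ⟨k, hk⟩ := h (Submodule.mem_span_singleton_self x)
    refine ⟨k, fun r hr v hv => ?_⟩
    obtain ⟨c, rfl⟩ := Submodule.mem_span_singleton.1 hv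
    rw [smul_comm, hk r hr, smul_zero]
  | sup N₁ N₂ _ _ h₁ h₂ =>
    intro h
    obtain ⟨k, hk⟩ := h₁ (le_sup_left.trans h)
    obtain ⟨l, hl⟩ := h₂ (le_sup_right.trans h)
    refine ⟨k + l, fun r hr v hv => ?_⟩
    obtain ⟨a, ha, b, hb, rfl⟩ := Submodule.mem_sup.1 hv
    rw [smul_add, hk r (Ideal.pow_le_pow_right (by omega) hr) a ha,
      hl r (Ideal.pow_le_pow_right (by omega) hr) b hb, add_zero]

lemma Gam_injective [IsNoetherianRing R] (E : Type) [AddCommGroup E] [Module R E]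
    [Module.Injective R E] : Module.Injective R (Gam 𝔞 E) := by
  apply Module.Baer.injective
  intro I g
  let g' : I →ₗ[R] E := (Gam 𝔞 E).subtype ∘ₗ g
  obtain ⟨k, hk⟩ := unif 𝔞 E (LinearMap.range g') (IsNoetherian.noetherian (⊤ : Submodule R I) |>.map g' |> fun h => by
    rwa [Submodule.map_top] at h) (by rintro _ ⟨x, rfl⟩; exact (g x).2)
  obtain ⟨c, hc⟩ := Ideal.exists_pow_inf_eq_pow_smul 𝔞 I
  have hAR : 𝔞 ^ (k + c) ⊓ I ≤ 𝔞 ^ k * I := by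
    have := hc (k + c) (by omega)
    rw [Nat.add_sub_cancel, smul_eq_mul, Ideal.mul_top] at this
    rw [this]
    exact Ideal.mul_mono_right inf_le_right
  let u : I →ₗ[R] (R ⧸ 𝔞 ^ (k + c)) := (𝔞 ^ (k + c)).mkQ ∘ₗ I.subtype
  have hgk0 : 𝔞 ^ k * I ≤ Submodule.map I.subtype (LinearMap.ker g') := by
    rw [Ideal.mul_le]
    intro a ha b hb
    refine ⟨a • ⟨b, hb⟩, ?_, rfl⟩
    rw [SetLike.mem_coe, LinearMap.mem_ker, map_smul]
    exact hk a ha _ ⟨_, rfl⟩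
  have hgk : ∀ y : R, y ∈ 𝔞 ^ k * I → ∀ hy : y ∈ I, g' ⟨y, hy⟩ = 0 := by
    intro y hy hyI
    obtain ⟨w, hw, rfl⟩ := hgk0 hy
    exact hw
  have hker : LinearMap.ker u ≤ LinearMap.ker g' := by
    intro y hy
    have : (y : R) ∈ 𝔞 ^ (k + c) := (Submodule.Quotient.mk_eq_zero _).1 hy
    exact hgk y (hAR ⟨this, y.2⟩) y.2
  obtain ⟨h, hh⟩ := Module.Injective.out (R := R) (Q := E) ((LinearMap.ker u).liftQ u le_rfl)
    (LinearMap.ker_eq_bot.1 (Submodule.ker_liftQ_eq_bot _ _ _ le_rfl)) ((LinearMap.ker u).liftQ g' hker)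
  have hh' : ∀ y : I, h (u y) = g' y := fun y => hh (Submodule.Quotient.mk y)
  have hmk : ∀ r : R, h (Submodule.Quotient.mk r) = r • h (Submodule.Quotient.mk 1) := by
    intro r
    rw [← map_smul, ← Submodule.Quotient.mk_smul, smul_eq_mul, mul_one]
  refine ⟨LinearMap.toSpanSingleton R _ ⟨h (Submodule.Quotient.mk 1), k + c, fun r hr => ?_⟩, ?_⟩
  · rw [← hmk, (Submodule.Quotient.mk_eq_zero _).2 hr, map_zero]
  · intro y hy
    apply Subtype.ext
    exact (hmk y).symm.trans (hh' ⟨y, hy⟩)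

def toHom {n : ℕ} {M : ModuleCat.{0} R} (v : M) (hv : ∀ r ∈ 𝔞 ^ n, r • v = 0) : Rq 𝔞 n ⟶ M :=
  ModuleCat.ofHom ((𝔞 ^ n).liftQ (LinearMap.toSpanSingleton R M v) hv)

lemma toHom_one {n : ℕ} {M : ModuleCat.{0} R} (v : M) (hv : ∀ r ∈ 𝔞 ^ n, r • v = 0) :
    (toHom 𝔞 v hv).hom (Submodule.Quotient.mk 1) = v := one_smul R v

lemma hom_ext_one {n : ℕ} {M : ModuleCat.{0} R} (f g : Rq 𝔞 n ⟶ M)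
    (h : f.hom (Submodule.Quotient.mk 1) = g.hom (Submodule.Quotient.mk 1)) : f = g := by
  ext
  exact h

/-- degree zero local cohomology: annihilation. -/
lemma T_zero_ann (M : ModuleCat.{0} R) (r : R) (hr : ∀ v : TT 𝔞 0 M, r • v = 0) (v : M)
    (hv : v ∈ Gam 𝔞 M) : r • v = 0 := by
  obtain ⟨k, hk⟩ := hv
  have h := hr (iota 𝔞 0 M k (Abelian.Ext.mk₀ (toHom 𝔞 v hk)))
  rw [← map_smul, ← Abelian.Ext.mk₀_smul] at h
  obtain ⟨m, hm, h0⟩ := iota_eq_zero 𝔞 0 M _ h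
  rw [Abelian.Ext.mk₀_comp_mk₀] at h0
  have h1 : pr 𝔞 hm ≫ (r • toHom 𝔞 v hk) = 0 := by
    apply (Abelian.Ext.mk₀_bijective _ _).1
    rw [h0, Abelian.Ext.mk₀_zero]
  have h2 := congrArg (fun f => f.hom (Submodule.Quotient.mk 1)) h1
  refine Eq.trans ?_ h2
  exact congrArg (r • ·) (toHom_one 𝔞 v hk).symm

lemma T_zero_surj {L Q : ModuleCat.{0} R} (g : L ⟶ Q) (hg : Function.Surjective g.hom)
    (hL : ∀ v : L, v ∈ Gam 𝔞 L) (q : TT 𝔞 0 Q) : ∃ u, Tmap 𝔞 0 g u = q := by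
  obtain ⟨n, e, rfl⟩ := iota_surj 𝔞 0 _ q
  obtain ⟨φ, rfl⟩ := (Abelian.Ext.mk₀_bijective _ _).2 e
  obtain ⟨v, hv⟩ := hg (φ.hom (Submodule.Quotient.mk 1))
  obtain ⟨k, hk⟩ := hL v
  have hk' : ∀ r ∈ 𝔞 ^ (n + k), r • v = 0 := fun r hr => hk r (Ideal.pow_le_pow_right (by omega) hr)
  refine ⟨iota 𝔞 0 L (n + k) (Abelian.Ext.mk₀ (toHom 𝔞 v hk')), ?_⟩
  rw [← iota_pr 𝔞 0 Q (Nat.le_add_right n k), iota_map, Abelian.Ext.mk₀_comp_mk₀,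
    Abelian.Ext.mk₀_comp_mk₀]
  congr 2
  apply hom_ext_one
  refine Eq.trans ?_ hv
  exact congrArg g.hom (toHom_one 𝔞 v hk')

def SC {A B C : Type} [AddCommGroup A] [Module R A] [AddCommGroup B] [Module R B]
    [AddCommGroup C] [Module R C] (f : A →ₗ[R] B) (g : B →ₗ[R] C) (h : Function.Exact f g) :
    ShortComplex (ModuleCat.{0} R) :=
  ShortComplex.mk (ModuleCat.ofHom f) (ModuleCat.ofHom g)
    (by ext v; exact h.apply_apply_eq_zero v)

lemma SC_exact {A B C : Type} [AddCommGroup A] [Module R A] [AddCommGroup B] [Module R B]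
    [AddCommGroup C] [Module R C] (f : A →ₗ[R] B) (g : B →ₗ[R] C) (h : Function.Exact f g)
    (hf : Function.Injective f) (hg : Function.Surjective g) : (SC f g h).ShortExact where
  exact := by
    rw [ShortComplex.ShortExact.moduleCat_exact_iff_function_exact]
    exact h
  mono_f := (ModuleCat.mono_iff_injective _).2 hf
  epi_g := (ModuleCat.epi_iff_surjective _).2 hg

lemma T_torsion [IsNoetherianRing R] (i : ℕ) : ∀ (L : ModuleCat.{0} R)
    (_ : ∀ v : L, v ∈ Gam 𝔞 L) (v : TT 𝔞 (i+1) L), v = 0 := by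
  induction i using Nat.strong_induction_on with
  | _ i ih =>
  intro L hL v
  let E := Injective.under L
  have hE : Injective (ModuleCat.of R E) := inferInstanceAs (Injective (Injective.under L))
  have : Module.Injective R E := Module.injective_module_of_injective_object R E
  have := Gam_injective 𝔞 E
  let f : L →ₗ[R] Gam 𝔞 E := LinearMap.codRestrict _ (Injective.ι L).hom (fun v => by
    obtain ⟨k, hk⟩ := hL v
    exact ⟨k, fun r hr => by rw [← map_smul, hk r hr, map_zero]⟩)
  have hf : Function.Injective f := by
    intro a b hab
    exact (ModuleCat.mono_iff_injective (Injective.ι L)).1 inferInstance (congrArg Subtype.val hab)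
  let g := (LinearMap.range f).mkQ
  have hfg : Function.Exact f g := LinearMap.exact_map_mkQ_range f
  have hg : Function.Surjective g := Submodule.mkQ_surjective _
  have hS := SC_exact f g hfg hf hg
  have htor : ∀ v : Gam 𝔞 E, v ∈ Gam 𝔞 (Gam 𝔞 E) := by
    rintro ⟨v, k, hk⟩
    exact ⟨k, fun r hr => Subtype.ext (hk r hr)⟩
  have : Injective (ModuleCat.of R (Gam 𝔞 E)) := Module.injective_object_of_injective_module R _
  obtain ⟨q, hq⟩ := exact₁ 𝔞 i hS v (T_injective 𝔞 i (ModuleCat.of R (Gam 𝔞 E)) _)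
  rw [← hq]
  have hQ : ∀ v : (Gam 𝔞 E ⧸ LinearMap.range f), v ∈ Gam 𝔞 (Gam 𝔞 E ⧸ LinearMap.range f) := by
    intro w
    obtain ⟨u, rfl⟩ := hg w
    obtain ⟨k, hk⟩ := htor u
    exact ⟨k, fun r hr => by rw [← map_smul, hk r hr, map_zero]⟩
  cases i with
  | zero =>
    obtain ⟨u, hu⟩ := T_zero_surj 𝔞 (SC f g hfg).g hg htor q
    rw [← hu]
    exact delta_Tmap 𝔞 0 hS u
  | succ j =>
    have hq0 : q = 0 := ih j (Nat.lt_succ_self j) (ModuleCat.of R _) hQ q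
    exact (congrArg _ hq0).trans (map_zero _)


lemma abstract_split {A B C D V : Type} [AddCommGroup A] [Module R A] [AddCommGroup B] [Module R B]
    [AddCommGroup C] [Module R C] [AddCommGroup D] [Module R D] [AddCommGroup V] [Module R V]
    (I : Ideal R) (j : A →ₗ[R] B) (d₁ : B →ₗ[R] C) (p : D →ₗ[R] C) (d₂ : V →ₗ[R] C)
    (h : V →ₗ[R] B) (hj : Function.Injective j) (hjd : ∀ a, d₁ (j a) = 0)
    (hdj : ∀ b, d₁ b = 0 → ∃ a, j a = b) (hp : Function.Bijective p)
    (hh : ∀ v, d₁ (h v) = d₂ v) (hk : ∀ v, d₂ v = 0 → h v = 0)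
    (hW : ∀ w : D, (∀ r ∈ I, r • w = 0) → ∃ v, d₂ v = p w)
    (hA : ∀ r ∈ I, ∀ a : A, r • a = 0) :
    Nonempty (Submodule.torsionBySet R B (I : Set R) ≃ₗ[R]
      A × Submodule.torsionBySet R D (I : Set R)) := by
  have memB : ∀ b : B, b ∈ Submodule.torsionBySet R B (I : Set R) ↔ ∀ r ∈ I, r • b = 0 := by
    intro b
    rw [Submodule.mem_torsionBySet_iff]
    exact ⟨fun H r hr => H ⟨r, hr⟩, fun H r => H r r.2⟩
  have memD : ∀ b : D, b ∈ Submodule.torsionBySet R D (I : Set R) ↔ ∀ r ∈ I, r • b = 0 := by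
    intro b
    rw [Submodule.mem_torsionBySet_iff]
    exact ⟨fun H r hr => H ⟨r, hr⟩, fun H r => H r r.2⟩
  have huniq : ∀ v v' : V, d₂ v = d₂ v' → h v = h v' := by
    intro v v' e
    rw [← sub_eq_zero, ← map_sub]
    exact hk _ (by rw [map_sub, e, sub_self])
  choose c hc using fun w : Submodule.torsionBySet R D (I : Set R) => hW w ((memD _).1 w.2)
  let s : Submodule.torsionBySet R D (I : Set R) →ₗ[R] B :=
    { toFun := fun w => h (c w)
      map_add' := fun w w' => by
        rw [← map_add]
        apply huniq
        rw [map_add, hc, hc, hc, Submodule.coe_add, map_add]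
      map_smul' := fun r w => by
        rw [RingHom.id_apply, ← map_smul]
        apply huniq
        rw [map_smul, hc, hc, Submodule.coe_smul, map_smul] }
  have hs : ∀ w, d₁ (s w) = p w := fun w => (hh _).trans (hc w)
  let F : A × Submodule.torsionBySet R D (I : Set R) →ₗ[R] B := j.coprod s
  have hF : ∀ z, F z ∈ Submodule.torsionBySet R B (I : Set R) := by
    intro z
    rw [memB]
    intro r hr
    rw [← map_smul]
    have : r • z = 0 := by
      refine Prod.ext (hA r hr _) (Subtype.ext ((memD _).1 z.2.2 r hr))
    rw [this, map_zero]
  refine ⟨(LinearEquiv.ofBijective (F.codRestrict _ hF) ⟨?_, ?_⟩).symm⟩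
  · rw [injective_iff_map_eq_zero]
    rintro ⟨a, w⟩ hz
    have hz' : j a + s w = 0 := congrArg Subtype.val hz
    have h1 := congrArg d₁ hz'
    rw [map_add, hjd, hs, zero_add, map_zero] at h1
    have hw : w = 0 := Subtype.ext (hp.1 (h1.trans (map_zero p).symm))
    subst hw
    rw [map_zero, add_zero] at hz'
    have ha : a = 0 := hj (hz'.trans (map_zero j).symm)
    rw [ha]
    rfl
  · rintro ⟨b, hb⟩
    obtain ⟨w, hw⟩ := hp.2 (d₁ b)
    have hwW : w ∈ Submodule.torsionBySet R D (I : Set R) := by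
      rw [memD]
      intro r hr
      apply hp.1
      rw [map_smul, hw, ← map_smul, (memB b).1 hb r hr, map_zero, map_zero]
    obtain ⟨a, ha⟩ := hdj (b - s ⟨w, hwW⟩) (by rw [map_sub, hs, hw, sub_self])
    refine ⟨(a, ⟨w, hwW⟩), Subtype.ext ?_⟩
    change j a + s ⟨w, hwW⟩ = b
    rw [ha, sub_add_cancel]

lemma exists_decomp (I : Ideal R) (x : R) (hx : x ∈ I * I) :
    ∃ (n : ℕ) (y z : Fin n → R), (∀ i, y i ∈ I) ∧ (∀ i, z i ∈ I) ∧ x = ∑ i, y i * z i := by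
  refine Submodule.mul_induction_on hx ?_ ?_
  · intro a ha b hb
    exact ⟨1, fun _ => a, fun _ => b, fun _ => ha, fun _ => hb, by simp⟩
  · rintro a b ⟨n, y, z, hy, hz, rfl⟩ ⟨n', y', z', hy', hz', rfl⟩
    refine ⟨n + n', Fin.append y y', Fin.append z z', ?_, ?_, ?_⟩
    · intro i
      refine Fin.addCases (fun i => ?_) (fun i => ?_) i <;> simp [hy, hy']
    · intro i
      refine Fin.addCases (fun i => ?_) (fun i => ?_) i <;> simp [hz, hz']
    · simp [Fin.sum_univ_add]

lemma ker_torsion [IsNoetherianRing R] (M : Type) [AddCommGroup M] [Module R M] [Module.Finite R M]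
    (x : R) (hfr : ∀ p ∈ associatedPrimes R M, ¬ 𝔞 ≤ p → x ∉ p) (v : M) (hv : x • v = 0) :
    v ∈ Gam 𝔞 M := by
  let L := LinearMap.ker (LinearMap.lsmul R M x)
  have hrad : 𝔞 ≤ (Module.annihilator R L).radical := by
    rw [← Ideal.sInf_minimalPrimes]
    refine le_sInf fun p hp => ?_
    have hpL := Module.associatedPrimes.minimalPrimes_annihilator_subset_associatedPrimes R L hp
    have hpM : p ∈ associatedPrimes R M :=
      associatedPrimes.subset_of_injective (f := L.subtype) L.injective_subtype hpL
    by_contra hn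
    refine hfr p hpM hn (hp.1.2 ?_)
    rw [Module.mem_annihilator]
    rintro ⟨m, hm⟩
    exact Subtype.ext hm
  obtain ⟨k, hk⟩ := Ideal.exists_pow_le_of_le_radical_of_fg hrad (IsNoetherian.noetherian 𝔞)
  refine ⟨k, fun r hr => ?_⟩
  have := Module.mem_annihilator.1 (hk hr) ⟨v, hv⟩
  exact congrArg Subtype.val this


lemma main_split [IsNoetherianRing R]
    (M : Type) [AddCommGroup M] [Module R M] [Module.Finite R M] (t n₀ : ℕ)
    (hann : ∀ i < t + 1, 𝔞 ^ n₀ ≤ Module.annihilator R (TT 𝔞 i (ModuleCat.of R M)))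
    (x : R) (hx : x ∈ 𝔞 ^ (2 * n₀))
    (hfr : ∀ p ∈ associatedPrimes R M, ¬ 𝔞 ≤ p → x ∉ p) :
    Nonempty ((Submodule.torsionBySet R
        (TT 𝔞 t (ModuleCat.of R (M ⧸ (Ideal.span {x} • (⊤ : Submodule R M)))))
        ((𝔞 ^ n₀ : Ideal R) : Set R)) ≃ₗ[R]
      (TT 𝔞 t (ModuleCat.of R M)) ×
      (Submodule.torsionBySet R (TT 𝔞 (t + 1) (ModuleCat.of R M))
        ((𝔞 ^ n₀ : Ideal R) : Set R))) := by
  have hx' : x ∈ 𝔞 ^ n₀ * 𝔞 ^ n₀ := by rwa [← pow_add, ← two_mul]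
  obtain ⟨n, y, z, hy, hz, hxyz⟩ := exists_decomp (𝔞 ^ n₀) x hx'
  have hkill : ∀ i ≤ t, ∀ r ∈ 𝔞 ^ n₀, ∀ v : TT 𝔞 i (ModuleCat.of R M), r • v = 0 :=
    fun i hi r hr => Module.mem_annihilator.1 (hann i (Nat.lt_succ_of_le hi) hr)
  have hker : ∀ v : M, x • v = 0 → v ∈ Gam 𝔞 M := ker_torsion 𝔞 M x hfr
  have hzk : ∀ r ∈ 𝔞 ^ n₀, ∀ v : M, x • v = 0 → r • v = 0 := fun r hr v hv =>
    T_zero_ann 𝔞 (ModuleCat.of R M) r (hkill 0 (Nat.zero_le t) r hr) v (hker v hv)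
  let L : Submodule R M := LinearMap.ker (LinearMap.lsmul R M x)
  let K : Submodule R M := Ideal.span {x} • (⊤ : Submodule R M)
  let xb : (M ⧸ L) →ₗ[R] M := L.liftQ (LinearMap.lsmul R M x) le_rfl
  have hxb : Function.Injective xb :=
    LinearMap.ker_eq_bot.1 (Submodule.ker_liftQ_eq_bot _ _ _ le_rfl)
  let zz : M →ₗ[R] (Fin n → M) := LinearMap.pi (fun i => LinearMap.lsmul R M (z i))
  let zb : (M ⧸ L) →ₗ[R] (Fin n → M) := L.liftQ zz (fun v hv => by
    rw [LinearMap.mem_ker]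
    funext i
    exact hzk (z i) (hz i) v hv)
  let yy : (Fin n → M) →ₗ[R] M := ∑ i, y i • LinearMap.proj i
  have hyz : ∀ w, yy (zb w) = xb w := by
    intro w
    obtain ⟨v, rfl⟩ := L.mkQ_surjective w
    change yy (zz v) = x • v
    simp only [yy, zz, LinearMap.sum_apply, LinearMap.smul_apply, LinearMap.proj_apply,
      LinearMap.pi_apply, LinearMap.lsmul_apply, hxyz, Finset.sum_smul, mul_smul]
  have hzb : Function.Injective zb := by
    intro a b hab
    apply hxb
    rw [← hyz, ← hyz, hab]
  have hxK : ∀ v : M, v ∈ K ↔ v ∈ LinearMap.range xb := by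
    intro v
    change v ∈ Ideal.span {x} • (⊤ : Submodule R M) ↔ _
    rw [Submodule.ideal_span_singleton_smul, Submodule.mem_smul_pointwise_iff_exists]
    constructor
    · rintro ⟨w, -, rfl⟩
      exact ⟨L.mkQ w, rfl⟩
    · rintro ⟨w, rfl⟩
      obtain ⟨w, rfl⟩ := L.mkQ_surjective w
      exact ⟨w, trivial, rfl⟩
  have hex1 : Function.Exact xb K.mkQ := by
    intro v
    rw [Submodule.mkQ_apply, Submodule.Quotient.mk_eq_zero, hxK]
    rfl
  have hex2 : Function.Exact zb (LinearMap.range zb).mkQ := LinearMap.exact_map_mkQ_range zb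
  have hex0 : Function.Exact L.subtype L.mkQ := by
    intro v
    rw [Submodule.mkQ_apply, Submodule.Quotient.mk_eq_zero]
    exact ⟨fun h => ⟨⟨v, h⟩, rfl⟩, fun ⟨w, hw⟩ => hw ▸ w.2⟩
  let yb : ((Fin n → M) ⧸ LinearMap.range zb) →ₗ[R] (M ⧸ K) := Submodule.mapQ _ K yy (by
    rintro _ ⟨w, rfl⟩
    exact (hxK _).2 ⟨w, (hyz w).symm⟩)
  have S1 := SC_exact xb K.mkQ hex1 hxb K.mkQ_surjective
  have S2 := SC_exact zb _ hex2 hzb (Submodule.mkQ_surjective _)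
  have S0 := SC_exact L.subtype L.mkQ hex0 L.injective_subtype L.mkQ_surjective
  let φ : SC zb _ hex2 ⟶ SC xb K.mkQ hex1 :=
    { τ₁ := 𝟙 _
      τ₂ := ModuleCat.ofHom yy
      τ₃ := ModuleCat.ofHom yb
      comm₁₂ := by
        ext w
        exact (hyz _).symm
      comm₂₃ := by
        ext w
        rfl }
  have hLtor : ∀ v : L, v ∈ Gam 𝔞 L := by
    rintro ⟨v, hv⟩
    obtain ⟨k, hk⟩ := hker v hv
    exact ⟨k, fun r hr => Subtype.ext (hk r hr)⟩
  have hTL : ∀ (i : ℕ) (v : TT 𝔞 (i+1) (ModuleCat.of R L)), v = 0 := fun i =>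
    T_torsion 𝔞 i (ModuleCat.of R L) hLtor
  let pi' : ModuleCat.of R M ⟶ ModuleCat.of R (M ⧸ L) := ModuleCat.ofHom L.mkQ
  have hsurj : ∀ (i : ℕ), Function.Surjective (Tmap 𝔞 i pi') := fun i v =>
    exact₃ 𝔞 i S0 v (hTL i _)
  have hinj : Function.Injective (Tmap 𝔞 (t+1) pi') := by
    rw [injective_iff_map_eq_zero]
    intro v hv
    obtain ⟨u, hu⟩ := exact₂ 𝔞 (t+1) S0 v hv
    rw [← hu, hTL t u]
    exact map_zero _
  have hTx : ∀ v : TT 𝔞 t (ModuleCat.of R (M ⧸ L)), Tmap 𝔞 t (ModuleCat.ofHom xb) v = 0 := by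
    intro v
    obtain ⟨u, rfl⟩ := hsurj t v
    have e : pi' ≫ ModuleCat.ofHom xb = x • 𝟙 (ModuleCat.of R M) := by
      ext w
      rfl
    rw [← Tmap_comp, e, Tmap_smul, Tmap_id]
    exact hkill t le_rfl x (Ideal.pow_le_pow_right (by omega) hx) u
  have hTy : ∀ v : TT 𝔞 t (ModuleCat.of R (Fin n → M)), Tmap 𝔞 t (ModuleCat.ofHom yy) v = 0 := by
    intro v
    have e : (ModuleCat.ofHom yy : ModuleCat.of R (Fin n → M) ⟶ ModuleCat.of R M) =
        ∑ i, y i • ModuleCat.ofHom (LinearMap.proj i) := by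
      ext w
      simp [yy, ModuleCat.hom_sum]
    rw [e, Tmap_sum]
    refine Finset.sum_eq_zero fun i _ => ?_
    rw [Tmap_smul]
    exact hkill t le_rfl (y i) (hy i) _
  refine abstract_split (A := TT 𝔞 t (ModuleCat.of R M)) (B := TT 𝔞 t (ModuleCat.of R (M ⧸ K)))
    (C := TT 𝔞 (t+1) (ModuleCat.of R (M ⧸ L))) (D := TT 𝔞 (t+1) (ModuleCat.of R M))
    (V := TT 𝔞 t (ModuleCat.of R ((Fin n → M) ⧸ LinearMap.range zb)))
    (𝔞 ^ n₀) (Tmap 𝔞 t (ModuleCat.ofHom K.mkQ)) (delta 𝔞 t S1)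
    (Tmap 𝔞 (t+1) pi') (delta 𝔞 t S2) (Tmap 𝔞 t (ModuleCat.ofHom yb)) ?_ ?_ ?_
    ⟨hinj, hsurj _⟩ ?_ ?_ ?_ (hkill t le_rfl)
  · rw [injective_iff_map_eq_zero]
    intro v hv
    obtain ⟨u, hu⟩ := exact₂ 𝔞 t S1 v hv
    rw [← hu]
    exact hTx u
  · exact delta_Tmap 𝔞 t S1
  · exact exact₃ 𝔞 t S1
  · intro v
    refine (delta_natural 𝔞 t S2 S1 φ v).trans ?_
    exact Tmap_id 𝔞 (t+1) _ _
  · intro v hv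
    obtain ⟨u, rfl⟩ := exact₃ 𝔞 t S2 v hv
    have e : (ModuleCat.ofHom (LinearMap.range zb).mkQ ≫ ModuleCat.ofHom yb :
        ModuleCat.of R (Fin n → M) ⟶ ModuleCat.of R (M ⧸ K)) =
        ModuleCat.ofHom yy ≫ ModuleCat.ofHom K.mkQ := by
      ext w
      rfl
    refine (Tmap_comp 𝔞 t (ModuleCat.ofHom (LinearMap.range zb).mkQ)
      (ModuleCat.ofHom yb) u).symm.trans ?_
    refine (congrArg (fun f => Tmap 𝔞 t f u) e).trans ?_
    refine (Tmap_comp 𝔞 t (ModuleCat.ofHom yy) (ModuleCat.ofHom K.mkQ) u).trans ?_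
    refine (congrArg _ (hTy u)).trans ?_
    exact map_zero _
  · intro w hw
    refine exact₁ 𝔞 t S2 _ ?_
    refine (Tmap_comp 𝔞 (t+1) pi' (ModuleCat.ofHom zb) w).symm.trans ?_
    have e : (pi' ≫ ModuleCat.ofHom zb : ModuleCat.of R M ⟶ ModuleCat.of R (Fin n → M)) =
        ∑ i, z i • ModuleCat.ofHom (LinearMap.single R (fun _ => M) i) := by
      ext v i
      simp only [ModuleCat.hom_sum, ModuleCat.hom_smul, ModuleCat.hom_ofHom, LinearMap.sum_apply,
        LinearMap.smul_apply, LinearMap.single_apply, Finset.sum_apply, Pi.smul_apply]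
      rw [Finset.sum_eq_single i]
      · rw [Pi.single_eq_same]
        rfl
      · intro k _ hk
        rw [Pi.single_eq_of_ne hk.symm, smul_zero]
      · intro hi
        exact absurd (Finset.mem_univ i) hi
    rw [e, Tmap_sum]
    refine Finset.sum_eq_zero fun i _ => ?_
    rw [Tmap_smul, ← map_smul, hw (z i) (hz i), map_zero]

end interface
end
end LCSplit

open CategoryTheory

/-- **Splitting theorem for local cohomology** (Theorem 1.1, second part).
If `𝔞 ^ n₀` annihilates `H^i_𝔞(M)` for all `i < t`, then for every `𝔞`-filter regular
element `x ∈ 𝔞 ^ (2 * n₀)` of `M` we have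
`(0 :_{H^{t-1}_𝔞(M/xM)} 𝔞^{n₀}) ≅ H^{t-1}_𝔞(M) ⊕ (0 :_{H^t_𝔞(M)} 𝔞^{n₀})`. -/
theorem localCohomology_quotient_top_torsion_splitting
    {R : Type} [CommRing R] [IsNoetherianRing R] (𝔞 : Ideal R)
    (M : Type) [AddCommGroup M] [Module R M] [Module.Finite R M]
    (t n₀ : ℕ) (ht : 0 < t) (hn₀ : 0 < n₀)
    (hann : ∀ i < t, 𝔞 ^ n₀ ≤ Module.annihilator R
      ((localCohomology 𝔞 i).obj (ModuleCat.of R M)))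
    (x : R) (hx : x ∈ 𝔞 ^ (2 * n₀))
    (hfr : ∀ p ∈ associatedPrimes R M, ¬ 𝔞 ≤ p → x ∉ p) :
    Nonempty ((Submodule.torsionBySet R
        ((localCohomology 𝔞 (t - 1)).obj
          (ModuleCat.of R (M ⧸ (Ideal.span {x} • (⊤ : Submodule R M)))))
        ((𝔞 ^ n₀ : Ideal R) : Set R)) ≃ₗ[R]
      ((localCohomology 𝔞 (t - 1)).obj (ModuleCat.of R M)) ×
      (Submodule.torsionBySet R
        ((localCohomology 𝔞 t).obj (ModuleCat.of R M))
        ((𝔞 ^ n₀ : Ideal R) : Set R))) := by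
  obtain ⟨t, rfl⟩ : ∃ s, t = s + 1 := ⟨t - 1, by omega⟩
  exact LCSplit.main_split 𝔞 M t n₀ hann x hx hfr
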